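/- For every set A of infinite binary sequences, the constructive dimension of A equals the supremum over sequences X in A of the constructive dimension of the singleton {X}. -/

import Mathlib

open Filter Topology

abbrev Cantor := ℕ → Bool

/-- The length-`n` prefix of an infinite binary sequence, as a list. -/
def pref (X : ℕ → Bool) (n : ℕ) : List Bool := (List.range n).map X

/-- An `s`-gale: a nonnegative function on strings satisfying the averaging
condition `2^s d(w) = d(w0) + d(w1)`. -/
def IsSGale (s : ℝ) (d : List Bool → ℝ) : Prop :=
  (∀ w, 0 ≤ d w) ∧ ∀ w, (2 : ℝ) ^ s * d w = d (w ++ [false]) + d (w ++ [true])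

/-- A real-valued function on strings is lower semicomputable (constructive):
it is the pointwise monotone limit of a computable rational approximation. -/
def LowerSemicomputable (d : List Bool → ℝ) : Prop :=
  ∃ g : List Bool → ℕ → ℚ, Computable₂ g ∧
    (∀ w, Monotone fun i => (g w i : ℝ)) ∧
    ∀ w, Filter.Tendsto (fun i => (g w i : ℝ)) Filter.atTop (nhds (d w))

/-- `d` succeeds on `X`: `limsup_n d(X↾n) = ∞`, i.e. `d` is unbounded on the
prefixes of `X`. -/
def SucceedsOn (d : List Bool → ℝ) (X : Cantor) : Prop :=
  ∀ C : ℝ, ∃ n, C < d (pref X n)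

/-- `d` strongly succeeds on `X`: `liminf_n d(X↾n) = ∞`. -/
def StronglySucceedsOn (d : List Bool → ℝ) (X : Cantor) : Prop :=
  ∀ C : ℝ, ∃ N, ∀ n ≥ N, C < d (pref X n)

/-- The constructive dimension of a class: the infimum of all `s ≥ 0` such that
some constructive (lower semicomputable) `s`-gale succeeds on every member. -/
noncomputable def cdim (A : Set Cantor) : ℝ :=
  sInf {s : ℝ | 0 ≤ s ∧ ∃ d : List Bool → ℝ,
    LowerSemicomputable d ∧ IsSGale s d ∧ ∀ X ∈ A, SucceedsOn d X}

/-- The constructive strong dimension of a class: the infimum of all `s ≥ 0`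
such that some constructive `s`-gale strongly succeeds on every member. -/
noncomputable def cDim (A : Set Cantor) : ℝ :=
  sInf {s : ℝ | 0 ≤ s ∧ ∃ d : List Bool → ℝ,
    LowerSemicomputable d ∧ IsSGale s d ∧ ∀ X ∈ A, StronglySucceedsOn d X}


section RatEncoding

theorem computable_find {α : Type*} [Primcodable α] (p : α → ℕ → Bool) (hp : Computable₂ p)
    (h : ∀ a, ∃ n, p a n = true) : Computable (fun a => Nat.find (h a)) := by
  have h1 : Partrec fun a => Nat.rfind (fun n => (Part.some (p a n))) :=
    Partrec.rfind hp.partrec₂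
  refine Partrec.of_eq_tot h1 (fun a => ?_)
  refine Nat.mem_rfind.2 ⟨?_, ?_⟩
  · simpa using (Nat.find_spec (h a)).symm
  · intro m hm
    have := Nat.find_min (h a) hm
    simpa using this

theorem computable_find' {α : Type*} [Primcodable α] (p : α → ℕ → Bool) (hp : Computable₂ p)
    (h : ∀ a, ∃ n, p a n = true) : ∃ f : α → ℕ, Computable f ∧ ∀ a, p a (f a) = true :=
  ⟨_, computable_find p hp h, fun a => Nat.find_spec (h a)⟩

theorem computable_subtype_ofNat (s : Set ℕ) [DecidablePred (· ∈ s)] [hi : Infinite s]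
    (hs : Computable fun n => decide (n ∈ s)) :
    Computable (fun n => (Nat.Subtype.ofNat s n : ℕ)) := by
  have hex : ∀ x : ℕ, ∃ m, decide (x + m + 1 ∈ s) = true := by
    intro x
    obtain ⟨b, hb, hxb⟩ := (Set.infinite_coe_iff.1 hi).exists_gt x
    refine ⟨b - x - 1, ?_⟩
    have : x + (b - x - 1) + 1 = b := by omega
    simpa [this] using hb
  have hstep : Computable (fun x : ℕ => Nat.find (hex x)) := by
    apply computable_find
    refine hs.comp ?_
    exact Primrec.to_comp (Primrec.nat_add.comp (Primrec.nat_add.comp Primrec.fst Primrec.snd) (Primrec.const 1))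
  have : Computable (fun n : ℕ => (Nat.rec (Nat.Subtype.ofNat s 0 : ℕ)
      (fun _ x => x + Nat.find (hex x) + 1) n : ℕ)) := by
    refine Computable.nat_rec (f := fun n => n) (g := fun _ => (Nat.Subtype.ofNat s 0 : ℕ))
      (h := fun _ y => y.2 + Nat.find (hex y.2) + 1) Computable.id (Computable.const _) ?_
    have h2 : Computable (fun p : ℕ × (ℕ × ℕ) => p.2.2) := Computable.snd.comp Computable.snd
    exact Computable.succ.comp ((Primrec.nat_add.to_comp).comp h2 (hstep.comp h2))
  refine this.of_eq fun n => ?_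
  induction n with
  | zero => rfl
  | succ n ih =>
    simp only at ih ⊢
    rw [ih, Nat.Subtype.ofNat, Nat.Subtype.succ]
    simp

/-- Base code of a rational. -/
def baseCode (q : ℚ) : ℕ := Nat.pair (Encodable.encode q.num) q.den

theorem baseCode_eq (q : ℚ) : @Encodable.encode ℚ Rat.instEncodable q = baseCode q := by
  rfl

instance infinite_range_rat : Infinite (Set.range (@Encodable.encode ℚ Rat.instEncodable)) :=
  Infinite.of_injective _ (Equiv.ofInjective _ Encodable.encode_injective).injective

theorem ratOfNat_eq (n : ℕ) :
    baseCode (Denumerable.ofNat ℚ n) =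
      (@Nat.Subtype.ofNat (Set.range (@Encodable.encode ℚ Rat.instEncodable))
        (@Encodable.decidableRangeEncode ℚ Rat.instEncodable) infinite_range_rat n : ℕ) :=
  congrArg Subtype.val ((@Encodable.equivRangeEncode ℚ Rat.instEncodable).apply_symm_apply
    (@Nat.Subtype.ofNat (Set.range (@Encodable.encode ℚ Rat.instEncodable))
        (@Encodable.decidableRangeEncode ℚ Rat.instEncodable) infinite_range_rat n))

theorem encode_int_nat (n : ℕ) : Encodable.encode (Int.ofNat n) = 2 * n := rfl
theorem encode_int_neg (n : ℕ) : Encodable.encode (Int.negSucc n) = 2 * n + 1 := rfl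

theorem encode_int_natAbs (z : ℤ) : z.natAbs = (Encodable.encode z + 1) / 2 := by
  cases z with
  | ofNat n => rw [encode_int_nat]; simp; omega
  | negSucc n => rw [encode_int_neg]; simp; omega

theorem mem_range_iff (k : ℕ) : k ∈ Set.range (@Encodable.encode ℚ Rat.instEncodable) ↔
    0 < k.unpair.2 ∧ ∀ c < k.unpair.2 + 1, ((k.unpair.1 + 1) / 2) % c = 0 → k.unpair.2 % c = 0 → c = 1 := by
  constructor
  · rintro ⟨q, rfl⟩
    rw [baseCode_eq, baseCode, Nat.unpair_pair]
    refine ⟨q.pos, fun c _ h1 h2 => ?_⟩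
    simp only at h1 h2
    rw [← encode_int_natAbs] at h1
    exact Nat.eq_one_of_dvd_coprimes q.reduced (Nat.dvd_of_mod_eq_zero h1) (Nat.dvd_of_mod_eq_zero h2)
  · rintro ⟨h0, h1⟩
    obtain ⟨z, hz⟩ : ∃ z : ℤ, Encodable.encode z = k.unpair.1 :=
      ⟨Denumerable.ofNat ℤ k.unpair.1, Denumerable.encode_ofNat _⟩
    rw [← hz, ← encode_int_natAbs] at h1
    have hc : z.natAbs.Coprime k.unpair.2 := by
      refine h1 _ ?_ ?_ ?_
      · exact Nat.lt_succ_of_le (Nat.gcd_le_right _ h0)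
      · exact Nat.mod_eq_zero_of_dvd (Nat.gcd_dvd_left _ _)
      · exact Nat.mod_eq_zero_of_dvd (Nat.gcd_dvd_right _ _)
    refine ⟨⟨z, k.unpair.2, h0.ne', hc⟩, ?_⟩
    rw [baseCode_eq, baseCode]
    simp only [hz, Nat.pair_unpair]

theorem computable_mem_range :
    PrimrecPred fun k : ℕ => k ∈ Set.range (@Encodable.encode ℚ Rat.instEncodable) := by
  have h1 : Primrec (fun k : ℕ => k.unpair.1) := Primrec.fst.comp Primrec.unpair
  have h2 : Primrec (fun k : ℕ => k.unpair.2) := Primrec.snd.comp Primrec.unpair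
  have hR : PrimrecRel (fun c k : ℕ => ((k.unpair.1 + 1) / 2) % c = 0 → k.unpair.2 % c = 0 → c = 1) := by
    have hc : Primrec (fun p : ℕ × ℕ => p.1) := Primrec.fst
    have a1 : Primrec (fun p : ℕ × ℕ => (p.2.unpair.1 + 1) / 2 % p.1) :=
      Primrec.nat_mod.comp (Primrec.nat_div.comp (Primrec.succ.comp (h1.comp Primrec.snd))
        (Primrec.const 2)) hc
    have a2 : Primrec (fun p : ℕ × ℕ => p.2.unpair.2 % p.1) :=
      Primrec.nat_mod.comp (h2.comp Primrec.snd) hc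
    have e1 := (Primrec.eq (α := ℕ)).comp a1 (Primrec.const 0)
    have e2 := (Primrec.eq (α := ℕ)).comp a2 (Primrec.const 0)
    have e3 := (Primrec.eq (α := ℕ)).comp hc (Primrec.const 1)
    refine PrimrecPred.of_eq (e1.not.or (e2.not.or e3)) ?_
    intro p
    simp only
    tauto
  have hall := (hR.forall_lt).comp (Primrec.succ.comp h2) Primrec.id
  have hpos := Primrec.nat_lt.comp (Primrec.const 0) h2
  refine (hpos.and hall).of_eq fun k => ?_
  rw [mem_range_iff]
  rfl

theorem computable_baseCode : Computable baseCode := by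
  have h := @computable_subtype_ofNat (Set.range (@Encodable.encode ℚ Rat.instEncodable))
        (@Encodable.decidableRangeEncode ℚ Rat.instEncodable) infinite_range_rat ?_
  · refine (h.comp (Computable.encode (α := ℚ))).of_eq fun q => ?_
    rw [← ratOfNat_eq, Denumerable.ofNat_encode]
  · obtain ⟨i, hi⟩ := computable_mem_range
    refine hi.to_comp.of_eq fun n => ?_
    congr

theorem computable_num : Computable (fun q : ℚ => Encodable.encode q.num) :=
  (Computable.fst.comp (Computable.unpair.comp computable_baseCode)).of_eq fun q => by
    simp [baseCode]

theorem computable_den : Computable (fun q : ℚ => q.den) :=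
  (Computable.snd.comp (Computable.unpair.comp computable_baseCode)).of_eq fun q => by
    simp [baseCode]

theorem computable_one_lt : Computable (fun q : ℚ => decide (1 < q)) := by
  have hp : PrimrecPred (fun x : ℕ × ℕ => x.1 % 2 = 0 ∧ 2 * x.2 < x.1) :=
    ((Primrec.eq (α := ℕ)).comp (Primrec.nat_mod.comp Primrec.fst (Primrec.const 2))
      (Primrec.const 0)).and
    (Primrec.nat_lt.comp (Primrec.nat_mul.comp (Primrec.const 2) Primrec.snd) Primrec.fst)
  obtain ⟨i, hp⟩ := hp
  refine (hp.to_comp.comp (computable_num.pair computable_den)).of_eq fun q => ?_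
  have hq : 1 < q ↔ (q.den : ℤ) < q.num := by
    conv_lhs => rw [← Rat.num_div_den q]
    rw [one_lt_div (by exact_mod_cast q.pos)]
    exact_mod_cast Iff.rfl
  rw [decide_eq_decide, hq]
  cases h : q.num with
  | ofNat n => simp only [encode_int_nat]; simp
  | negSucc n => simp only [encode_int_neg]; simp; omega

theorem computable_natDiv : Computable (fun p : ℕ × ℕ => (p.1 : ℚ) / ((p.2 + 1 : ℕ) : ℚ)) := by
  have hex : ∀ p : ℕ × ℕ, ∃ n, (fun (p : ℕ × ℕ) n => decide (Encodable.encode (Denumerable.ofNat ℚ n).num % 2 = 0 ∧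
      Encodable.encode (Denumerable.ofNat ℚ n).num * (p.2 + 1) = 2 * (p.1 * (Denumerable.ofNat ℚ n).den))) p n = true := by
    intro p
    refine ⟨@Encodable.encode ℚ Rat.instDenumerable.toEncodable ((p.1 : ℚ) / ((p.2 + 1 : ℕ) : ℚ)), ?_⟩
    simp only [Denumerable.ofNat_encode, decide_eq_true_eq]
    set q := (p.1 : ℚ) / ((p.2 + 1 : ℕ) : ℚ) with hq
    have h0 : 0 ≤ q.num := Rat.num_nonneg.2 (by positivity)
    obtain ⟨n, hn⟩ := Int.eq_ofNat_of_zero_le h0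
    have e : Encodable.encode q.num = 2 * n := by rw [hn]; exact encode_int_nat n
    have h1 : q * ((p.2 + 1 : ℕ) : ℚ) = p.1 := by rw [hq]; field_simp
    have h2 : (q.num : ℚ) = q * q.den := (Rat.mul_den_eq_num q).symm
    rw [hn] at h2
    have h3 : (n : ℚ) * ((p.2 + 1 : ℕ) : ℚ) = p.1 * q.den := by
      have : ((n : ℤ) : ℚ) = (n : ℚ) := by norm_cast
      rw [this] at h2
      rw [h2, ← h1]; ring
    have h4 : n * (p.2 + 1) = p.1 * q.den := by exact_mod_cast h3
    rw [e, ← h4]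
    exact ⟨by omega, by ring⟩
  have hc := computable_find' _ ?_ hex
  · obtain ⟨f, hf, hfs⟩ := hc
    refine ((Computable.ofNat ℚ).comp hf).of_eq fun p => ?_
    have := hfs p
    simp only [decide_eq_true_eq] at this
    obtain ⟨t1, t2⟩ := this
    revert t1 t2
    generalize Denumerable.ofNat ℚ (f p) = q
    intro t1 t2
    rw [eq_div_iff (by positivity)]
    cases h : q.num with
    | ofNat n =>
      rw [h, encode_int_nat] at t2
      have h2 : (q.num : ℚ) = q * q.den := (Rat.mul_den_eq_num q).symm
      have h5 : n * (p.2 + 1) = p.1 * q.den := by nlinarith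
      have h6 : (n : ℚ) * ((p.2 + 1 : ℕ) : ℚ) = p.1 * q.den := by exact_mod_cast h5
      rw [h] at h2
      have : ((Int.ofNat n : ℤ) : ℚ) = (n : ℚ) := by simp
      rw [this] at h2
      rw [h2] at h6
      have hd : (q.den : ℚ) ≠ 0 := by exact_mod_cast q.den_nz
      apply mul_right_cancel₀ hd
      linarith
    | negSucc n => rw [h, encode_int_neg] at t1; omega
  · have hp : PrimrecPred (fun x : (ℕ × ℕ) × (ℕ × ℕ) => x.1.1 % 2 = 0 ∧
        x.1.1 * (x.2.2 + 1) = 2 * (x.2.1 * x.1.2)) := by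
      have a11 : Primrec (fun x : (ℕ × ℕ) × (ℕ × ℕ) => x.1.1) := Primrec.fst.comp Primrec.fst
      have a12 : Primrec (fun x : (ℕ × ℕ) × (ℕ × ℕ) => x.1.2) := Primrec.snd.comp Primrec.fst
      have a21 : Primrec (fun x : (ℕ × ℕ) × (ℕ × ℕ) => x.2.1) := Primrec.fst.comp Primrec.snd
      have a22 : Primrec (fun x : (ℕ × ℕ) × (ℕ × ℕ) => x.2.2) := Primrec.snd.comp Primrec.snd
      exact ((Primrec.eq (α := ℕ)).comp (Primrec.nat_mod.comp a11 (Primrec.const 2))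
        (Primrec.const 0)).and
        ((Primrec.eq (α := ℕ)).comp (Primrec.nat_mul.comp a11 (Primrec.succ.comp a22))
          (Primrec.nat_mul.comp (Primrec.const 2) (Primrec.nat_mul.comp a21 a12)))
    obtain ⟨i, hp⟩ := hp
    have hq : Computable (fun x : (ℕ × ℕ) × ℕ => Denumerable.ofNat ℚ x.2) :=
      (Computable.ofNat ℚ).comp Computable.snd
    refine (hp.to_comp.comp (((computable_num.comp hq).pair (computable_den.comp hq)).pair
      Computable.fst)).of_eq fun x => ?_
    rw [decide_eq_decide]

end RatEncoding

section UniversalGale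

/-- Weight of the gale attached to a string of length `n`, evaluated at a compatible string. -/
noncomputable def wt (r : ℝ) (l n : ℕ) : ℝ := (n + 1) * r ^ l * (r⁻¹) ^ n * (1 / 2) ^ (l - n)

def hitb (stage : ℕ → ℕ → Option (List Bool)) (w : List Bool) (m k : ℕ) : Bool :=
  (stage k m).elim false (fun v => decide (v.take w.length = w.take m.unpair.1))

open Classical in
noncomputable def galeTerm (stage : ℕ → ℕ → Option (List Bool)) (r : ℝ) (w : List Bool) (m : ℕ) : ℝ :=
  if ∃ k, hitb stage w m k = true then wt r w.length m.unpair.1 else 0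

variable {stage : ℕ → ℕ → Option (List Bool)}

theorem wt_nonneg {r : ℝ} (hr : 0 < r) (l n : ℕ) : 0 ≤ wt r l n := by
  unfold wt; positivity

theorem galeTerm_nonneg {r : ℝ} (hr : 0 < r) (w : List Bool) (m : ℕ) : 0 ≤ galeTerm stage r w m := by
  unfold galeTerm
  split_ifs
  · exact wt_nonneg hr _ _
  · exact le_rfl

theorem hitb_mono (h1 : ∀ k k' m v, k ≤ k' → stage k m = some v → stage k' m = some v)
    {w : List Bool} {m k k' : ℕ} (hk : k ≤ k') (h : hitb stage w m k = true) :
    hitb stage w m k' = true := by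
  unfold hitb at *
  cases hs : stage k m with
  | none => simp [hs] at h
  | some v => rw [h1 k k' m v hk hs]; rw [hs] at h; exact h

theorem hit_iff (h1 : ∀ k k' m v, k ≤ k' → stage k m = some v → stage k' m = some v)
    {m k : ℕ} {v : List Bool} (hs : stage k m = some v) (w : List Bool) :
    (∃ k, hitb stage w m k = true) ↔ v.take w.length = w.take m.unpair.1 := by
  constructor
  · rintro ⟨k', hk'⟩
    have := hitb_mono h1 (le_max_right k k') hk'
    unfold hitb at this
    rw [h1 k _ m v (le_max_left k k') hs] at this
    simpa using this
  · intro h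
    refine ⟨k, ?_⟩
    unfold hitb
    rw [hs]
    simpa using h

theorem galeTerm_gale (h1 : ∀ k k' m v, k ≤ k' → stage k m = some v → stage k' m = some v)
    (h2 : ∀ k m v, stage k m = some v → v.length = m.unpair.1) {r : ℝ}
    (w : List Bool) (m : ℕ) :
    r * galeTerm stage r w m =
      galeTerm stage r (w ++ [false]) m + galeTerm stage r (w ++ [true]) m := by
  by_cases hex : ∃ k v, stage k m = some v
  · obtain ⟨k, v, hs⟩ := hex
    have hl := h2 k m v hs
    unfold galeTerm
    simp only [hit_iff h1 hs]
    generalize m.unpair.1 = n at *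
    rcases lt_or_ge w.length n with hlt | hge
    · have e1 : w.take n = w := List.take_of_length_le hlt.le
      have e2 : ∀ b, (w ++ [b]).take n = w ++ [b] := fun b =>
        List.take_of_length_le (by simp; omega)
      have e3 : v.take (w.length + 1) = v.take w.length ++ [v[w.length]'(by omega)] := by
        rw [List.take_succ_eq_append_getElem]
      have e4 : ∀ b, wt r (w ++ [b]).length n = r * wt r w.length n := by
        intro b
        have a1 : w.length + 1 - n = 0 := by omega
        have a2 : w.length - n = 0 := by omega
        simp only [wt, List.length_append, List.length_singleton, a1, a2]
        ring
      simp only [e1, e2, e4]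
      simp only [List.length_append, List.length_singleton, e3]
      by_cases hw : v.take w.length = w
      · rw [hw]
        cases hb : v[w.length]'(by omega) <;> simp
      · have : ∀ b c, v.take w.length ++ [c] ≠ w ++ [b] := by
          intro b c h
          exact hw (List.append_inj_left' h rfl)
        rw [if_neg hw, if_neg (this _ _), if_neg (this _ _)]
        simp
    · have e1 : v.take w.length = v := List.take_of_length_le (by omega)
      have e2 : ∀ b, v.take (w ++ [b]).length = v := fun b =>
        List.take_of_length_le (by simp; omega)
      have e3 : ∀ b, (w ++ [b]).take n = w.take n := fun b => List.take_append_of_le_length hge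
      have e4 : ∀ b, wt r (w ++ [b]).length n = r / 2 * wt r w.length n := by
        intro b
        have a1 : w.length + 1 - n = (w.length - n) + 1 := by omega
        simp only [wt, List.length_append, List.length_singleton, a1]
        ring
      simp only [e1, e2, e3, e4]
      split_ifs <;> ring
  · have : ∀ w, galeTerm stage r w m = 0 := by
      intro w
      unfold galeTerm
      rw [if_neg]
      rintro ⟨k, hk⟩
      apply hex
      unfold hitb at hk
      cases hs : stage k m with
      | none => simp [hs] at hk
      | some v => exact ⟨k, v, hs⟩
    simp [this]

/-- Total mass dominating the gale terms. -/
noncomputable def massBound (M : Set ℕ) (r : ℝ) : ℕ → ℝ :=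
  M.indicator (fun m => ((m.unpair.1 : ℝ) + 1) * (r⁻¹) ^ m.unpair.1)

theorem hitb_mem {M : Set ℕ} (h3 : ∀ k m v, stage k m = some v → m ∈ M) {w : List Bool} {m k : ℕ}
    (h : hitb stage w m k = true) : m ∈ M := by
  unfold hitb at h
  cases hs : stage k m with
  | none => simp [hs] at h
  | some v => exact h3 k m v hs

theorem wt_le {r : ℝ} (hr : 0 < r) (l n : ℕ) : wt r l n ≤ r ^ l * ((n + 1) * (r⁻¹) ^ n) := by
  unfold wt
  have : ((1 : ℝ) / 2) ^ (l - n) ≤ 1 := pow_le_one₀ (by norm_num) (by norm_num)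
  calc _ ≤ ((n : ℝ) + 1) * r ^ l * (r⁻¹) ^ n * 1 := by gcongr
    _ = _ := by ring

theorem galeTerm_le {M : Set ℕ} (h3 : ∀ k m v, stage k m = some v → m ∈ M) {r : ℝ} (hr : 0 < r)
    (w : List Bool) (m : ℕ) : galeTerm stage r w m ≤ r ^ w.length * massBound M r m := by
  unfold galeTerm
  split_ifs with h
  · obtain ⟨k, hk⟩ := h
    rw [massBound, Set.indicator_of_mem (hitb_mem h3 hk)]
    exact wt_le hr _ _
  · refine mul_nonneg (by positivity) (Set.indicator_nonneg (fun m _ => by positivity) _)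

theorem galeTerm_summable {M : Set ℕ} (h3 : ∀ k m v, stage k m = some v → m ∈ M) {r : ℝ}
    (hr : 0 < r) (hM : Summable (massBound M r)) (w : List Bool) :
    Summable (galeTerm stage r w) :=
  Summable.of_nonneg_of_le (galeTerm_nonneg hr w) (galeTerm_le h3 hr w) (hM.mul_left _)

noncomputable def bigGale (stage : ℕ → ℕ → Option (List Bool)) (r : ℝ) (w : List Bool) : ℝ :=
  ∑' m, galeTerm stage r w m

def numer (stage : ℕ → ℕ → Option (List Bool)) (P Q : ℕ) (w : List Bool) (i : ℕ) : ℕ :=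
  ∑ m ∈ Finset.range i, bif hitb stage w m i then
    (m.unpair.1 + 1) * P ^ w.length * Q ^ m.unpair.1 * P ^ (i - m.unpair.1) *
      2 ^ (min m.unpair.1 w.length) else 0

def denom (P Q : ℕ) (w : List Bool) (i : ℕ) : ℕ := Q ^ w.length * P ^ i * 2 ^ w.length

theorem approx_eq {P Q : ℕ} (hP : 0 < P) (hQ : 0 < Q) (w : List Bool) (i : ℕ) :
    (numer stage P Q w i : ℝ) / (denom P Q w i : ℝ) =
    ∑ m ∈ Finset.range i, if hitb stage w m i = true then
      wt ((P : ℝ) / Q) w.length m.unpair.1 else 0 := by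
  have hP' : (P : ℝ) ≠ 0 := by positivity
  have hQ' : (Q : ℝ) ≠ 0 := by positivity
  unfold numer
  push_cast
  rw [Finset.sum_div]
  refine Finset.sum_congr rfl fun m hm => ?_
  have hmi : m.unpair.1 ≤ i := (Nat.unpair_left_le m).trans (Finset.mem_range.1 hm).le
  generalize m.unpair.1 = n at *
  cases hitb stage w m i
  · simp
  · simp only [cond_true, if_true, denom, wt]
    push_cast
    obtain ⟨c, rfl⟩ := Nat.exists_eq_add_of_le hmi
    have e : ((1 : ℝ) / 2) ^ (w.length - n) = 2 ^ (min n w.length) / 2 ^ w.length := by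
      rw [eq_div_iff (by positivity), one_div, inv_pow, inv_mul_eq_div, div_eq_iff (by positivity),
        ← pow_add]
      congr 1
      omega
    rw [e, inv_div, div_pow, div_pow]
    have : n + c - n = c := by omega
    rw [this, pow_add]
    field_simp

theorem approx_mono (h1 : ∀ k k' m v, k ≤ k' → stage k m = some v → stage k' m = some v)
    {r : ℝ} (hr : 0 < r) (w : List Bool) :
    Monotone fun i => ∑ m ∈ Finset.range i, if hitb stage w m i = true then
      wt r w.length m.unpair.1 else 0 := by
  intro i i' hi
  refine (Finset.sum_le_sum (fun m _ => ?_)).trans (Finset.sum_le_sum_of_subset_of_nonneg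
    (Finset.range_mono hi) ?_)
  · split_ifs with a b
    · exact le_rfl
    · exact absurd (hitb_mono h1 hi a) b
    · exact wt_nonneg hr _ _
    · exact le_rfl
  · intro m _ _
    split_ifs
    · exact wt_nonneg hr _ _
    · exact le_rfl

theorem approx_tendsto (h1 : ∀ k k' m v, k ≤ k' → stage k m = some v → stage k' m = some v)
    {M : Set ℕ} (h3 : ∀ k m v, stage k m = some v → m ∈ M) {r : ℝ}
    (hr : 0 < r) (hM : Summable (massBound M r)) (w : List Bool) :
    Tendsto (fun i => ∑ m ∈ Finset.range i, if hitb stage w m i = true then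
      wt r w.length m.unpair.1 else 0) atTop (𝓝 (bigGale stage r w)) := by
  have key : ∀ i, (∑ m ∈ Finset.range i, if hitb stage w m i = true then
      wt r w.length m.unpair.1 else 0) = ∑' m, if m < i ∧ hitb stage w m i = true then
      wt r w.length m.unpair.1 else 0 := by
    intro i
    rw [tsum_eq_sum (s := Finset.range i)]
    · refine Finset.sum_congr rfl fun m hm => ?_
      simp [Finset.mem_range.1 hm]
    · intro m hm
      rw [if_neg]
      simp only [Finset.mem_range] at hm
      tauto
  simp only [key]
  refine tendsto_tsum_of_dominated_convergence (galeTerm_summable h3 hr hM w) ?_ ?_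
  · intro m
    apply tendsto_const_nhds.congr'
    by_cases hex : ∃ k, hitb stage w m k = true
    · obtain ⟨k, hk⟩ := hex
      filter_upwards [eventually_ge_atTop (k + m + 1)] with i hi
      rw [galeTerm, if_pos ⟨k, hk⟩, if_pos ⟨by omega, hitb_mono h1 (by omega) hk⟩]
    · filter_upwards with i
      rw [galeTerm, if_neg hex, if_neg]
      rintro ⟨_, h⟩
      exact hex ⟨i, h⟩
  · filter_upwards with i m
    split_ifs with h
    · rw [Real.norm_of_nonneg (wt_nonneg hr _ _), galeTerm, if_pos ⟨i, h.2⟩]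
    · simpa using galeTerm_nonneg hr w m

theorem bigGale_isSGale (h1 : ∀ k k' m v, k ≤ k' → stage k m = some v → stage k' m = some v)
    (h2 : ∀ k m v, stage k m = some v → v.length = m.unpair.1)
    {M : Set ℕ} (h3 : ∀ k m v, stage k m = some v → m ∈ M) {r s : ℝ}
    (hr : 0 < r) (hs : (2 : ℝ) ^ s = r) (hM : Summable (massBound M r)) :
    IsSGale s (bigGale stage r) := by
  refine ⟨fun w => tsum_nonneg (galeTerm_nonneg hr w), fun w => ?_⟩
  rw [hs]
  unfold bigGale
  rw [← tsum_mul_left, ← (galeTerm_summable h3 hr hM _).tsum_add (galeTerm_summable h3 hr hM _)]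
  exact tsum_congr (galeTerm_gale h1 h2 w)

theorem bigGale_ge (h1 : ∀ k k' m v, k ≤ k' → stage k m = some v → stage k' m = some v)
    (h2 : ∀ k m v, stage k m = some v → v.length = m.unpair.1)
    {M : Set ℕ} (h3 : ∀ k m v, stage k m = some v → m ∈ M) {r : ℝ}
    (hr : 0 < r) (hM : Summable (massBound M r)) {k m : ℕ} {v : List Bool}
    (hs : stage k m = some v) : (v.length : ℝ) + 1 ≤ bigGale stage r v := by
  have : galeTerm stage r v m = (v.length : ℝ) + 1 := by
    unfold galeTerm
    rw [if_pos, ← h2 k m v hs, wt]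
    · simp only [Nat.sub_self, pow_zero, mul_one]
      rw [mul_assoc, ← mul_pow, mul_inv_cancel₀ hr.ne']
      simp
    · rw [hit_iff h1 hs, h2 k m v hs]
  rw [← this]
  exact (galeTerm_summable h3 hr hM v).le_tsum m (fun j _ => galeTerm_nonneg hr v j)

theorem primrec_pow : Primrec₂ (fun a b : ℕ => a ^ b) :=
  Primrec₂.unpaired'.1 Nat.Primrec.pow

theorem primrec_hitb (hst : Primrec₂ stage) :
    Primrec (fun x : (List Bool × ℕ) × ℕ => hitb stage x.1.1 x.2 x.1.2) := by
  unfold hitb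
  have hw : Primrec (fun x : (List Bool × ℕ) × ℕ => x.1.1) := Primrec.fst.comp Primrec.fst
  have hi : Primrec (fun x : (List Bool × ℕ) × ℕ => x.1.2) := Primrec.snd.comp Primrec.fst
  have hm : Primrec (fun x : (List Bool × ℕ) × ℕ => x.2) := Primrec.snd
  have hn : Primrec (fun x : (List Bool × ℕ) × ℕ => x.2.unpair.1) :=
    Primrec.fst.comp (Primrec.unpair.comp hm)
  have ho := hst.comp hi hm
  have hd : Primrec₂ (fun (x : (List Bool × ℕ) × ℕ) (v : List Bool) =>
      decide (v.take x.1.1.length = x.1.1.take x.2.unpair.1)) := by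
    have : PrimrecPred (fun y : ((List Bool × ℕ) × ℕ) × List Bool =>
      y.2.take y.1.1.1.length = y.1.1.1.take y.1.2.unpair.1) :=
      (Primrec.eq (α := List Bool)).comp
        (Primrec.list_take.comp (Primrec.list_length.comp (hw.comp Primrec.fst)) Primrec.snd)
        (Primrec.list_take.comp (hn.comp Primrec.fst) (hw.comp Primrec.fst))
    obtain ⟨i, hp⟩ := this
    exact hp.of_eq fun y => by rw [decide_eq_decide]
  refine (Primrec.option_casesOn ho (Primrec.const false) hd).of_eq fun x => ?_
  cases stage x.1.2 x.2 <;> rfl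

theorem primrec_numer (hst : Primrec₂ stage) (P Q : ℕ) :
    Primrec (fun x : List Bool × ℕ => numer stage P Q x.1 x.2) := by
  have hw : Primrec (fun x : (List Bool × ℕ) × ℕ => x.1.1.length) :=
    Primrec.list_length.comp (Primrec.fst.comp Primrec.fst)
  have hi : Primrec (fun x : (List Bool × ℕ) × ℕ => x.1.2) := Primrec.snd.comp Primrec.fst
  have hm : Primrec (fun x : (List Bool × ℕ) × ℕ => x.2) := Primrec.snd
  have hn : Primrec (fun x : (List Bool × ℕ) × ℕ => x.2.unpair.1) :=
    Primrec.fst.comp (Primrec.unpair.comp hm)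
  have hterm : Primrec (fun x : (List Bool × ℕ) × ℕ =>
      bif hitb stage x.1.1 x.2 x.1.2 then
      (x.2.unpair.1 + 1) * P ^ x.1.1.length * Q ^ x.2.unpair.1 * P ^ (x.1.2 - x.2.unpair.1) *
        2 ^ (min x.2.unpair.1 x.1.1.length) else 0) := by
    refine Primrec.cond (primrec_hitb hst) ?_ (Primrec.const 0)
    refine Primrec.nat_mul.comp (Primrec.nat_mul.comp (Primrec.nat_mul.comp (Primrec.nat_mul.comp
      (Primrec.succ.comp hn) (primrec_pow.comp (Primrec.const P) hw))
      (primrec_pow.comp (Primrec.const Q) hn))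
      (primrec_pow.comp (Primrec.const P) (Primrec.nat_sub.comp hi hn)))
      (primrec_pow.comp (Primrec.const 2) (Primrec.nat_min.comp hn hw))
  have : Primrec (fun x : List Bool × ℕ => (Nat.rec 0 (fun m acc => acc +
      bif hitb stage x.1 m x.2 then
      (m.unpair.1 + 1) * P ^ x.1.length * Q ^ m.unpair.1 * P ^ (x.2 - m.unpair.1) *
        2 ^ (min m.unpair.1 x.1.length) else 0) x.2 : ℕ)) := by
    refine Primrec.nat_rec' (f := fun x : List Bool × ℕ => x.2) (g := fun _ => 0)
      (h := fun x y => y.2 + bif hitb stage x.1 y.1 x.2 then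
      (y.1.unpair.1 + 1) * P ^ x.1.length * Q ^ y.1.unpair.1 * P ^ (x.2 - y.1.unpair.1) *
        2 ^ (min y.1.unpair.1 x.1.length) else 0) Primrec.snd (Primrec.const 0) ?_
    exact Primrec.nat_add.comp (Primrec.snd.comp Primrec.snd)
      (hterm.comp (Primrec.pair Primrec.fst (Primrec.fst.comp Primrec.snd)))
  refine this.of_eq fun x => ?_
  unfold numer
  generalize x.2 = i
  have : ∀ t, (Nat.rec 0 (fun m acc => acc +
      bif hitb stage x.1 m i then
      (m.unpair.1 + 1) * P ^ x.1.length * Q ^ m.unpair.1 * P ^ (i - m.unpair.1) *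
        2 ^ (min m.unpair.1 x.1.length) else 0) t : ℕ) = ∑ m ∈ Finset.range t, bif hitb stage x.1 m i then
    (m.unpair.1 + 1) * P ^ x.1.length * Q ^ m.unpair.1 * P ^ (i - m.unpair.1) *
      2 ^ (min m.unpair.1 x.1.length) else 0 := by
    intro t
    induction t with
    | zero => rfl
    | succ t ih => rw [Finset.sum_range_succ, ← ih]
  exact this i

theorem primrec_denom (P Q : ℕ) : Primrec (fun x : List Bool × ℕ => denom P Q x.1 x.2) := by
  have hw : Primrec (fun x : List Bool × ℕ => x.1.length) := Primrec.list_length.comp Primrec.fst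
  exact Primrec.nat_mul.comp (Primrec.nat_mul.comp (primrec_pow.comp (Primrec.const Q) hw)
    (primrec_pow.comp (Primrec.const P) Primrec.snd)) (primrec_pow.comp (Primrec.const 2) hw)

theorem bigGale_lsc (h1 : ∀ k k' m v, k ≤ k' → stage k m = some v → stage k' m = some v)
    (hst : Primrec₂ stage)
    {M : Set ℕ} (h3 : ∀ k m v, stage k m = some v → m ∈ M) {P Q : ℕ} (hP : 0 < P) (hQ : 0 < Q)
    (hM : Summable (massBound M ((P : ℝ) / Q))) :
    LowerSemicomputable (bigGale stage ((P : ℝ) / Q)) := by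
  have hr : 0 < (P : ℝ) / Q := by positivity
  have hg : ∀ w i, (((numer stage P Q w i : ℚ) / ((denom P Q w i - 1 + 1 : ℕ) : ℚ) : ℚ) : ℝ) =
      ∑ m ∈ Finset.range i, if hitb stage w m i = true then
      wt ((P : ℝ) / Q) w.length m.unpair.1 else 0 := by
    intro w i
    rw [← approx_eq hP hQ]
    have : 0 < denom P Q w i := by unfold denom; positivity
    rw [Nat.sub_add_cancel this]
    push_cast
    rfl
  refine ⟨fun w i => (numer stage P Q w i : ℚ) / ((denom P Q w i - 1 + 1 : ℕ) : ℚ), ?_, ?_, ?_⟩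
  · have hN : Computable (fun x : List Bool × ℕ => numer stage P Q x.1 x.2) :=
      (primrec_numer hst P Q).to_comp
    have hD : Computable (fun x : List Bool × ℕ => denom P Q x.1 x.2 - 1) :=
      Primrec.to_comp (Primrec.nat_sub.comp (primrec_denom P Q) (Primrec.const 1))
    exact Computable₂.mk ((computable_natDiv.comp (hN.pair hD)).of_eq fun x => rfl)
  · intro w
    simp only [hg]
    exact approx_mono h1 hr w
  · intro w
    simp only [hg]
    exact approx_tendsto h1 h3 hr hM w

end UniversalGale

section Stages

open Nat.Partrec (Code)

/-- Pairs `(n, (e, j))` with `e ≤ n` and `j < (p/q)^n`. -/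
def admissible (p q : ℕ) : Set ℕ :=
  {m | m.unpair.2.unpair.1 ≤ m.unpair.1 ∧ m.unpair.2.unpair.2 * q ^ m.unpair.1 < p ^ m.unpair.1}

instance (p q : ℕ) : DecidablePred (· ∈ admissible p q) := fun m =>
  inferInstanceAs (Decidable (m.unpair.2.unpair.1 ≤ m.unpair.1 ∧
    m.unpair.2.unpair.2 * q ^ m.unpair.1 < p ^ m.unpair.1))

def stageU (p q k m : ℕ) : Option (List Bool) :=
  (((Code.evaln k (Denumerable.ofNat Code m.unpair.2.unpair.1)
    (Nat.pair m.unpair.1 m.unpair.2.unpair.2)).bind (Encodable.decode (α := List Bool))).bind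
    fun v => if v.length = m.unpair.1 ∧ m ∈ admissible p q then some v else none)

theorem stageU_mono (p q : ℕ) : ∀ k k' m v, k ≤ k' → stageU p q k m = some v →
    stageU p q k' m = some v := by
  intro k k' m v hk h
  unfold stageU at *
  rw [Option.bind_eq_some_iff] at h ⊢
  obtain ⟨u, hu, h2⟩ := h
  refine ⟨u, ?_, h2⟩
  rw [Option.bind_eq_some_iff] at hu ⊢
  obtain ⟨x, hx, h3⟩ := hu
  exact ⟨x, Code.evaln_mono hk hx, h3⟩

theorem stageU_spec (p q : ℕ) {k m v} (h : stageU p q k m = some v) :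
    v.length = m.unpair.1 ∧ m ∈ admissible p q := by
  unfold stageU at *
  rw [Option.bind_eq_some_iff] at h
  obtain ⟨u, hu, h2⟩ := h
  split_ifs at h2 with hc
  rw [← Option.some.inj h2]
  exact hc

theorem stageU_complete (p q : ℕ) {c : Code} {n j : ℕ} {v : List Bool} (hc : Encodable.encode c ≤ n)
    (hj : j * q ^ n < p ^ n) (hv : v.length = n)
    (h : Encodable.encode v ∈ Code.eval c (Nat.pair n j)) :
    ∃ k, stageU p q k (Nat.pair n (Nat.pair (Encodable.encode c) j)) = some v := by
  obtain ⟨k, hk⟩ := Code.evaln_complete.1 h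
  refine ⟨k, ?_⟩
  unfold stageU
  simp only [Nat.unpair_pair, Denumerable.ofNat_encode]
  rw [Option.mem_def.1 hk]
  simp only [Option.bind_some, Encodable.encodek]
  rw [if_pos]
  refine ⟨hv, ?_⟩
  simp only [admissible, Set.mem_ofPred_eq, Nat.unpair_pair]
  exact ⟨hc, hj⟩

theorem primrec_stageU (p q : ℕ) : Primrec₂ (stageU p q) := by
  have hn : Primrec (fun m : ℕ => m.unpair.1) := Primrec.fst.comp Primrec.unpair
  have hm2 : Primrec (fun m : ℕ => m.unpair.2) := Primrec.snd.comp Primrec.unpair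
  have he : Primrec (fun m : ℕ => m.unpair.2.unpair.1) := hn.comp hm2
  have hj : Primrec (fun m : ℕ => m.unpair.2.unpair.2) := hm2.comp hm2
  have h1 : Primrec (fun x : ℕ × ℕ => Code.evaln x.1 (Denumerable.ofNat Code x.2.unpair.2.unpair.1)
    (Nat.pair x.2.unpair.1 x.2.unpair.2.unpair.2)) :=
    Code.primrec_evaln.comp (Primrec.pair (Primrec.pair Primrec.fst
      ((Primrec.ofNat Code).comp (he.comp Primrec.snd)))
      (Primrec₂.natPair.comp (hn.comp Primrec.snd) (hj.comp Primrec.snd)))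
  refine Primrec.option_bind (Primrec.option_bind h1 (Primrec.decode.comp Primrec.snd).to₂) ?_
  have hadm : PrimrecPred (fun m : ℕ => m ∈ admissible p q) :=
    (Primrec.nat_le.comp he hn).and (Primrec.nat_lt.comp
      (Primrec.nat_mul.comp hj (primrec_pow.comp (Primrec.const q) hn))
      (primrec_pow.comp (Primrec.const p) hn))
  have hlen : PrimrecPred (fun x : (ℕ × ℕ) × List Bool => x.2.length = x.1.2.unpair.1) :=
    (Primrec.eq (α := ℕ)).comp (Primrec.list_length.comp Primrec.snd)
      (hn.comp (Primrec.snd.comp Primrec.fst))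
  have hc := hlen.and (hadm.comp (f := fun x : (ℕ × ℕ) × List Bool => x.1.2)
    (Primrec.snd.comp Primrec.fst))
  exact Primrec.ite hc (Primrec.option_some.comp Primrec.snd) (Primrec.const none)

theorem summable_massBound {p q : ℕ} {r : ℝ} (hq : 0 < q) (h1 : 1 ≤ (p : ℝ) / q)
    (hr : (p : ℝ) / q < r) : Summable (massBound (admissible p q) r) := by
  have hr0 : 0 < r := by linarith
  set ρ : ℝ := (p : ℝ) / q with hρ
  rw [← Nat.pairEquiv.summable_iff]
  have hnn : ∀ m, 0 ≤ massBound (admissible p q) r m := fun m =>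
    Set.indicator_nonneg (fun m _ => by positivity) _
  let B : ℕ → ℕ := fun n => p ^ n / q ^ n + 1
  have hB : ∀ n, (B n : ℝ) ≤ 2 * ρ ^ n := by
    intro n
    have a : ((p ^ n / q ^ n : ℕ) : ℝ) ≤ ρ ^ n := by
      rw [hρ, div_pow]
      exact_mod_cast Nat.cast_div_le (α := ℝ) (m := p ^ n) (n := q ^ n)
    have b : 1 ≤ ρ ^ n := one_le_pow₀ h1
    simp only [B]
    push_cast at a ⊢
    linarith
  let S : ℕ → Finset ℕ := fun n =>
    ((Finset.range (n + 1)) ×ˢ (Finset.range (B n))).image (fun y => Nat.pair y.1 y.2)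
  have hS : ∀ n y, y ∉ S n → massBound (admissible p q) r (Nat.pair n y) = 0 := by
    intro n y hy
    apply Set.indicator_of_notMem
    rintro ⟨ha, hb⟩
    simp only [Nat.unpair_pair] at ha hb
    apply hy
    refine Finset.mem_image.2 ⟨y.unpair, ?_, Nat.pair_unpair y⟩
    simp only [Finset.mem_product, Finset.mem_range, B]
    refine ⟨by omega, Nat.lt_succ_of_le ?_⟩
    exact (Nat.le_div_iff_mul_le (by positivity)).2 hb.le
  have hle : ∀ n y, massBound (admissible p q) r (Nat.pair n y) ≤ ((n : ℝ) + 1) * (r⁻¹) ^ n := by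
    intro n y
    unfold massBound
    by_cases h : Nat.pair n y ∈ admissible p q
    · rw [Set.indicator_of_mem h]
      simp
    · rw [Set.indicator_of_notMem h]
      positivity
  refine (summable_prod_of_nonneg (f := massBound (admissible p q) r ∘ Nat.pairEquiv)
    (fun x => hnn _)).2 ⟨fun n => summable_of_ne_finset_zero (s := S n) (fun y hy => hS n y hy), ?_⟩
  have hx : 0 ≤ ρ / r := by positivity
  have hx1 : ρ / r < 1 := (div_lt_one hr0).2 hr
  have hsum : Summable (fun n : ℕ => 8 * ((n : ℝ) ^ 2 * (ρ / r) ^ n) + 8 * (ρ / r) ^ n) := by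
    refine Summable.add (Summable.mul_left _ ?_) (Summable.mul_left _ ?_)
    · exact summable_pow_mul_geometric_of_norm_lt_one 2 (by rwa [Real.norm_of_nonneg hx])
    · exact summable_geometric_of_lt_one hx hx1
  refine Summable.of_nonneg_of_le (fun n => tsum_nonneg fun y => hnn _) (fun n => ?_) hsum
  rw [tsum_eq_sum (f := fun y => (massBound (admissible p q) r ∘ Nat.pairEquiv) (n, y)) (s := S n)
    (fun y hy => hS n y hy)]
  calc ∑ y ∈ S n, (massBound (admissible p q) r ∘ Nat.pairEquiv) (n, y)
      ≤ ∑ y ∈ S n, ((n : ℝ) + 1) * (r⁻¹) ^ n := Finset.sum_le_sum fun y _ => hle n y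
    _ = (S n).card * (((n : ℝ) + 1) * (r⁻¹) ^ n) := by rw [Finset.sum_const, nsmul_eq_mul]
    _ ≤ (((n : ℝ) + 1) * (2 * ρ ^ n)) * (((n : ℝ) + 1) * (r⁻¹) ^ n) := by
        gcongr
        calc ((S n).card : ℝ) ≤ (((n + 1) * B n : ℕ) : ℝ) := by
              refine Nat.cast_le.2 (Finset.card_image_le.trans ?_)
              simp
          _ ≤ _ := by push_cast; gcongr; exact hB n
    _ = 2 * ((n : ℝ) + 1) ^ 2 * (ρ / r) ^ n := by rw [div_eq_mul_inv, mul_pow]; ring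
    _ ≤ _ := by
        have : 0 ≤ (ρ / r) ^ n := by positivity
        have h2 : 2 * ((n : ℝ) + 1) ^ 2 ≤ 8 * (n : ℝ) ^ 2 + 8 := by nlinarith [sq_nonneg ((n : ℝ) - 1)]
        nlinarith

end Stages

section Enumeration

def strs : ℕ → List (List Bool)
  | 0 => [[]]
  | n + 1 => (strs n).map (List.cons false) ++ (strs n).map (List.cons true)

theorem mem_strs (w : List Bool) : w ∈ strs w.length := by
  induction w with
  | nil => simp [strs]
  | cons b w ih => cases b <;> simp [strs, ih]

theorem nodup_strs (n : ℕ) : (strs n).Nodup := by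
  induction n with
  | zero => simp [strs]
  | succ n ih =>
    rw [strs, List.nodup_append]
    refine ⟨ih.map List.cons_injective, ih.map List.cons_injective, ?_⟩
    intro a ha b hb
    rw [List.mem_map] at ha hb
    obtain ⟨x, _, rfl⟩ := ha
    obtain ⟨y, _, rfl⟩ := hb
    simp

theorem gale_sum {s : ℝ} {d : List Bool → ℝ} (hd : IsSGale s d) (n : ℕ) :
    ∀ u, ((strs n).map (fun w => d (u ++ w))).sum = ((2 : ℝ) ^ s) ^ n * d u := by
  induction n with
  | zero => intro u; simp [strs]
  | succ n ih =>
    intro u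
    have h0 := ih (u ++ [false])
    have h1 := ih (u ++ [true])
    simp only [List.append_assoc, List.singleton_append] at h0 h1
    simp only [strs, List.map_append, List.sum_append, List.map_map, Function.comp_def]
    rw [h0, h1, ← mul_add, ← hd.2 u]
    ring

theorem gale_card {s : ℝ} {d : List Bool → ℝ} (hd : IsSGale s d) (n : ℕ) (S : Finset (List Bool))
    (hS : ∀ w ∈ S, w.length = n ∧ 1 < d w) : (S.card : ℝ) ≤ ((2 : ℝ) ^ s) ^ n * d [] := by
  have h := gale_sum hd n []
  simp only [List.nil_append] at h
  rw [← h, ← List.sum_toFinset d (nodup_strs n)]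
  calc (S.card : ℝ) = ∑ w ∈ S, (1 : ℝ) := by simp
    _ ≤ ∑ w ∈ S, d w := Finset.sum_le_sum fun w hw => (hS w hw).2.le
    _ ≤ _ := by
      refine Finset.sum_le_sum_of_subset_of_nonneg ?_ (fun w _ _ => hd.1 w)
      intro w hw
      rw [List.mem_toFinset, ← (hS w hw).1]
      exact mem_strs w

variable (g : List Bool → ℕ → ℚ)

/-- `k` codes a pair `(w, i)` where `w` has length `n` and `i` is the first stage with `g w i > 1`. -/
def evt (n k : ℕ) : Bool :=
  (Encodable.decode₂ (List Bool) k.unpair.1).elim false fun w =>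
    decide (w.length = n) && (decide (1 < g w k.unpair.2) &&
      (decide (k.unpair.2 = 0) || !decide (1 < g w (k.unpair.2 - 1))))

def evtCount (n k : ℕ) : ℕ := Nat.rec 0 (fun t acc => acc + bif evt g n t then 1 else 0) k

def evtFun (x : ℕ) : Part ℕ :=
  (Nat.rfind fun k => Part.some
    (evt g x.unpair.1 k && decide (evtCount g x.unpair.1 k = x.unpair.2))).map fun k => k.unpair.1

theorem evt_iff (n k : ℕ) : evt g n k = true ↔ ∃ w : List Bool, Encodable.encode w = k.unpair.1 ∧
    w.length = n ∧ 1 < g w k.unpair.2 ∧ (k.unpair.2 = 0 ∨ ¬ 1 < g w (k.unpair.2 - 1)) := by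
  unfold evt
  constructor
  · intro h
    cases hd : Encodable.decode₂ (List Bool) k.unpair.1 with
    | none => simp [hd] at h
    | some w =>
      refine ⟨w, Encodable.mem_decode₂.1 hd, ?_⟩
      rw [hd] at h
      simpa using h
  · rintro ⟨w, hw, h⟩
    rw [Option.mem_def.1 (Encodable.mem_decode₂.2 hw)]
    simpa using h

variable {g}

theorem computable_evt (hg : Computable₂ g) : Computable₂ (evt g) := by
  have hk : Computable (fun x : ℕ × ℕ => x.2.unpair) := Computable.unpair.comp Computable.snd
  have hdec : Computable (fun x : ℕ × ℕ => Encodable.decode₂ (List Bool) x.2.unpair.1) :=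
    Primrec.decode₂.to_comp.comp (Computable.fst.comp hk)
  have hbody : Computable (fun y : (ℕ × ℕ) × List Bool => decide (y.2.length = y.1.1) &&
      (decide (1 < g y.2 y.1.2.unpair.2) &&
      (decide (y.1.2.unpair.2 = 0) || !decide (1 < g y.2 (y.1.2.unpair.2 - 1))))) := by
    have hi : Computable (fun y : (ℕ × ℕ) × List Bool => y.1.2.unpair.2) :=
      Computable.snd.comp (hk.comp Computable.fst)
    have eqc : ∀ {a b : (ℕ × ℕ) × List Bool → ℕ}, Computable a → Computable b →
        Computable (fun y => decide (a y = b y)) := by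
      intro a b ha hb
      obtain ⟨i, hp⟩ := (Primrec.eq (α := ℕ))
      refine (hp.to_comp.comp (ha.pair hb)).of_eq fun y => ?_
      rw [decide_eq_decide]
    have b1 := eqc (Computable.list_length.comp Computable.snd)
      (Computable.fst.comp Computable.fst)
    have b2 := computable_one_lt.comp (hg.comp Computable.snd hi)
    have b3 := eqc hi (Computable.const 0)
    have b4 := computable_one_lt.comp (hg.comp Computable.snd (Computable.pred.comp hi))
    exact Primrec.and.to_comp.comp b1 (Primrec.and.to_comp.comp b2
      (Primrec.or.to_comp.comp b3 (Primrec.not.to_comp.comp b4)))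
  refine (Computable.option_casesOn hdec (Computable.const false) hbody.to₂).of_eq fun x => ?_
  unfold evt
  cases Encodable.decode₂ (List Bool) x.2.unpair.1 <;> rfl

theorem computable_evtCount (hg : Computable₂ g) : Computable₂ (evtCount g) := by
  refine Computable.nat_rec (f := fun x : ℕ × ℕ => x.2) (g := fun _ => 0)
    (h := fun x y => y.2 + bif evt g x.1 y.1 then 1 else 0) Computable.snd (Computable.const 0) ?_
  have he : Computable (fun x : (ℕ × ℕ) × (ℕ × ℕ) => evt g x.1.1 x.2.1) :=
    (computable_evt hg).comp (Computable.fst.comp Computable.fst)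
      (Computable.fst.comp Computable.snd)
  exact Primrec.nat_add.to_comp.comp (Computable.snd.comp Computable.snd)
    (Computable.cond he (Computable.const 1) (Computable.const 0))

theorem partrec_evtFun (hg : Computable₂ g) : Nat.Partrec (evtFun g) := by
  refine Partrec.nat_iff.1 ?_
  have hn : Computable (fun x : ℕ × ℕ => x.1.unpair.1) :=
    Computable.fst.comp (Computable.unpair.comp Computable.fst)
  have hj : Computable (fun x : ℕ × ℕ => x.1.unpair.2) :=
    Computable.snd.comp (Computable.unpair.comp Computable.fst)
  have hb : Computable (fun x : ℕ × ℕ =>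
      (evt g x.1.unpair.1 x.2 && decide (evtCount g x.1.unpair.1 x.2 = x.1.unpair.2))) := by
    refine Primrec.and.to_comp.comp ((computable_evt hg).comp hn Computable.snd) ?_
    obtain ⟨i, hp⟩ := (Primrec.eq (α := ℕ))
    refine (hp.to_comp.comp (((computable_evtCount hg).comp hn Computable.snd).pair hj)).of_eq
      fun y => ?_
    rw [decide_eq_decide]
  have hb2 : Computable₂ (fun x k : ℕ =>
      (evt g x.unpair.1 k && decide (evtCount g x.unpair.1 k = x.unpair.2))) := hb
  have h1 := Partrec.rfind hb2.partrec₂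
  exact h1.map ((Computable.fst.comp (Computable.unpair.comp Computable.snd)).to₂)

theorem evtCount_eq (n k : ℕ) :
    evtCount g n k = ((Finset.range k).filter fun t => evt g n t = true).card := by
  induction k with
  | zero => rfl
  | succ k ih =>
    rw [Finset.range_add_one, Finset.filter_insert]
    have : evtCount g n (k + 1) = evtCount g n k + bif evt g n k then 1 else 0 := rfl
    rw [this, ih]
    cases h : evt g n k
    · simp
    · simp

theorem evtFun_mem {n k : ℕ} (h : evt g n k = true) :
    k.unpair.1 ∈ evtFun g (Nat.pair n (evtCount g n k)) := by
  unfold evtFun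
  simp only [Nat.unpair_pair]
  refine (Part.mem_map_iff _).2 ⟨k, Nat.mem_rfind.2 ⟨?_, ?_⟩, rfl⟩
  · simp [h]
  · intro k' hk'
    have : ¬ (evt g n k' = true ∧ evtCount g n k' = evtCount g n k) := by
      rintro ⟨ha, hb⟩
      rw [evtCount_eq, evtCount_eq] at hb
      refine absurd hb (Finset.card_lt_card ?_).ne
      refine Finset.ssubset_iff_of_subset ?_ |>.2 ⟨k', ?_, ?_⟩
      · exact Finset.filter_subset_filter _ (Finset.range_mono hk'.le)
      · simp [hk', ha]
      · simp
    simp only [Part.mem_some_iff]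
    symm
    rw [Bool.and_eq_false_iff]
    by_cases ha : evt g n k' = true
    · right; simpa using fun hb => this ⟨ha, hb⟩
    · left; simpa using ha

theorem evtCount_le (hmono : ∀ w, Monotone fun i => (g w i : ℝ)) {d : List Bool → ℝ}
    (hlim : ∀ w, Tendsto (fun i => (g w i : ℝ)) atTop (𝓝 (d w))) {s : ℝ} (hd : IsSGale s d)
    (n k : ℕ) : (evtCount g n k : ℝ) ≤ ((2 : ℝ) ^ s) ^ n * d [] := by
  rw [evtCount_eq]
  have key : ∀ t, evt g n t = true → ∃ w : List Bool, Encodable.encode w = t.unpair.1 ∧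
    w.length = n ∧ 1 < g w t.unpair.2 ∧ (t.unpair.2 = 0 ∨ ¬ 1 < g w (t.unpair.2 - 1)) :=
    fun t => (evt_iff g n t).1
  let f : ℕ → List Bool := fun t => (Encodable.decode (α := List Bool) t.unpair.1).getD []
  have hf : ∀ t (w : List Bool), Encodable.encode w = t.unpair.1 → f t = w := by
    intro t w h
    simp only [f, ← h, Encodable.encodek, Option.getD_some]
  have hmq : ∀ w, Monotone (g w) := fun w i j hij => by
    have h : (g w i : ℝ) ≤ g w j := hmono w hij
    exact_mod_cast h
  rw [← Finset.card_image_of_injOn (f := f)]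
  · apply gale_card hd
    intro w hw
    obtain ⟨t, ht, rfl⟩ := Finset.mem_image.1 hw
    obtain ⟨w, h1, h2, h3, _⟩ := key t (Finset.mem_filter.1 ht).2
    rw [hf t w h1]
    refine ⟨h2, ?_⟩
    have h4 : (1 : ℝ) < g w t.unpair.2 := by exact_mod_cast h3
    exact h4.trans_le ((hmono w).ge_of_tendsto (hlim w) _)
  · intro t ht t' ht' hEq
    obtain ⟨w, h1, h2, h3, h4⟩ := key t (Finset.mem_filter.1 ht).2
    obtain ⟨w', h1', h2', h3', h4'⟩ := key t' (Finset.mem_filter.1 ht').2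
    rw [hf t w h1, hf t' w' h1'] at hEq
    subst hEq
    have hi : t.unpair.2 = t'.unpair.2 := by
      rcases lt_trichotomy t.unpair.2 t'.unpair.2 with h | h | h
      · rcases h4' with h5 | h5
        · omega
        · exact absurd (h3.trans_le (hmq w (by omega))) h5
      · exact h
      · rcases h4 with h5 | h5
        · omega
        · exact absurd (h3'.trans_le (hmq w (by omega))) h5
    rw [← Nat.pair_unpair t, ← Nat.pair_unpair t', ← h1, ← h1', hi]

theorem exists_evt {d : List Bool → ℝ}
    (hlim : ∀ w, Tendsto (fun i => (g w i : ℝ)) atTop (𝓝 (d w))) {w : List Bool} (hw : 1 < d w) :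
    ∃ k, evt g w.length k = true ∧ k.unpair.1 = Encodable.encode w := by
  have hex : ∃ i, 1 < g w i := by
    obtain ⟨i, hi⟩ := ((hlim w).eventually_const_lt hw).exists
    exact ⟨i, by exact_mod_cast hi⟩
  classical
  refine ⟨Nat.pair (Encodable.encode w) (Nat.find hex), ?_, by simp⟩
  rw [evt_iff]
  refine ⟨w, by simp, rfl, by simpa using Nat.find_spec hex, ?_⟩
  simp only [Nat.unpair_pair]
  by_cases h : Nat.find hex = 0
  · exact Or.inl h
  · exact Or.inr (Nat.find_min hex (by omega))

end Enumeration

section Main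

theorem pref_length (X : Cantor) (n : ℕ) : (pref X n).length = n := by simp [pref]

theorem universal_succeeds {p q : ℕ} {r : ℝ} (hq : 0 < q) (h1 : 1 ≤ (p : ℝ) / q)
    (hr : (p : ℝ) / q < r) {s : ℝ} (hs : (2 : ℝ) ^ s < (p : ℝ) / q) {d : List Bool → ℝ}
    (hd : IsSGale s d) (hl : LowerSemicomputable d) {X : Cantor} (hX : SucceedsOn d X) :
    SucceedsOn (bigGale (stageU p q) r) X := by
  obtain ⟨g, hg, hmono, hlim⟩ := hl
  obtain ⟨c, hc⟩ := Nat.Partrec.Code.exists_code.1 (partrec_evtFun hg)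
  have hr0 : 0 < r := by linarith
  have h2s : (0 : ℝ) < 2 ^ s := by positivity
  have hsmall : ∀ᶠ n : ℕ in atTop, ((2 : ℝ) ^ s) ^ n * d [] < ((p : ℝ) / q) ^ n := by
    have ht : Tendsto (fun n : ℕ => ((2 : ℝ) ^ s / ((p : ℝ) / q)) ^ n * d []) atTop (𝓝 0) := by
      have := (tendsto_pow_atTop_nhds_zero_of_lt_one (r := (2 : ℝ) ^ s / ((p : ℝ) / q))
        (by positivity) ((div_lt_one (by linarith)).2 hs)).mul_const (d [])
      simpa using this
    filter_upwards [ht.eventually_lt_const one_pos] with n hn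
    have hp : 0 < ((p : ℝ) / q) ^ n := by positivity
    rw [div_pow, div_mul_eq_mul_div, div_lt_one hp] at hn
    exact hn
  obtain ⟨N, hN⟩ := eventually_atTop.1 hsmall
  intro C
  obtain ⟨K, hK⟩ := exists_nat_gt C
  set L := N + K + Encodable.encode c with hL
  -- find a long prefix with value above one
  obtain ⟨n, hn⟩ := hX (1 + ∑ i ∈ Finset.range L, d (pref X i))
  have hsn : 0 ≤ ∑ i ∈ Finset.range L, d (pref X i) := Finset.sum_nonneg fun i _ => hd.1 _
  have hnL : L ≤ n := by
    by_contra hlt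
    have := Finset.single_le_sum (f := fun i => d (pref X i)) (fun i _ => hd.1 _)
      (Finset.mem_range.2 (not_le.1 hlt))
    linarith
  have hone : 1 < d (pref X n) := by linarith
  obtain ⟨k, hk, hkw⟩ := exists_evt hlim hone
  rw [pref_length] at hk
  have hcount := (evtCount_le hmono hlim hd n k).trans_lt (hN n (by omega))
  have hj : evtCount g n k * q ^ n < p ^ n := by
    rw [div_pow, lt_div_iff₀ (by positivity)] at hcount
    exact_mod_cast hcount
  have hmem := evtFun_mem hk
  rw [hkw, ← hc] at hmem
  obtain ⟨k', hk'⟩ := stageU_complete p q (c := c) (n := n) (by omega) hj (pref_length X n) hmem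
  refine ⟨n, ?_⟩
  have hge := bigGale_ge (stageU_mono p q) (fun k m v h => (stageU_spec p q h).1)
    (fun k m v h => (stageU_spec p q h).2) hr0 (summable_massBound hq h1 hr) hk'
  rw [pref_length] at hge
  have : (K : ℝ) ≤ n := by exact_mod_cast (by omega : K ≤ n)
  linarith

def galeSet (A : Set Cantor) : Set ℝ := {s : ℝ | 0 ≤ s ∧ ∃ d : List Bool → ℝ,
    LowerSemicomputable d ∧ IsSGale s d ∧ ∀ X ∈ A, SucceedsOn d X}

theorem galeSet_bdd (A : Set Cantor) : BddBelow (galeSet A) := ⟨0, fun _ h => h.1⟩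

theorem two_mem_galeSet (A : Set Cantor) : 2 ∈ galeSet A := by
  refine ⟨by norm_num, fun w => 2 ^ w.length, ?_, ⟨fun w => by positivity, fun w => ?_⟩, ?_⟩
  · refine ⟨fun w _ => ((2 ^ w.length : ℕ) : ℚ) / ((0 + 1 : ℕ) : ℚ), ?_, ?_, ?_⟩
    · have hN : Computable (fun x : List Bool × ℕ => 2 ^ x.1.length) :=
        Primrec.to_comp (primrec_pow.comp (Primrec.const 2) (Primrec.list_length.comp Primrec.fst))
      have hD : Computable (fun x : List Bool × ℕ => 0) := Computable.const 0
      exact Computable₂.mk ((computable_natDiv.comp (hN.pair hD)).of_eq fun x => rfl)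
    · intro w
      exact monotone_const
    · intro w
      simp
  · rw [show (2 : ℝ) ^ (2 : ℝ) = 4 by norm_num]
    simp only [List.length_append, List.length_singleton, pow_succ]
    ring
  · intro X _ C
    obtain ⟨n, hn⟩ := pow_unbounded_of_one_lt C (one_lt_two (α := ℝ))
    exact ⟨n, by simpa [pref_length] using hn⟩

theorem cdim_nonneg (A : Set Cantor) : 0 ≤ cdim A := Real.sInf_nonneg fun _ h => h.1

theorem cdim_le_two (A : Set Cantor) : cdim A ≤ 2 := csInf_le (galeSet_bdd A) (two_mem_galeSet A)

theorem cdim_mono {A B : Set Cantor} (h : A ⊆ B) : cdim A ≤ cdim B :=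
  csInf_le_csInf (galeSet_bdd A) ⟨2, two_mem_galeSet B⟩
    fun _ ⟨h0, d, h1, h2, h3⟩ => ⟨h0, d, h1, h2, fun X hX => h3 X (h hX)⟩

theorem cdim_le_of_forall {A : Set Cantor} {σ : ℝ} (h0 : 0 ≤ σ) (h : ∀ X ∈ A, cdim {X} ≤ σ) :
    cdim A ≤ σ := by
  refine le_of_forall_gt_imp_ge_of_dense fun t ht => ?_
  have hlt : (2 : ℝ) ^ σ < 2 ^ t := Real.rpow_lt_rpow_of_exponent_lt one_lt_two ht
  have hone : (1 : ℝ) ≤ 2 ^ σ := Real.one_le_rpow one_le_two h0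
  obtain ⟨r, hr1, hr2⟩ := exists_rat_btwn hlt
  obtain ⟨ρ, hρ1, hρ2⟩ := exists_rat_btwn hr1
  have conv : ∀ x : ℚ, (0 : ℝ) < x → ∃ P Q : ℕ, 0 < P ∧ 0 < Q ∧ (x : ℝ) = (P : ℝ) / Q := by
    intro x hx
    have hx' : 0 < x := by exact_mod_cast hx
    have hnum := Rat.num_pos.2 hx'
    refine ⟨x.num.toNat, x.den, by omega, x.pos, ?_⟩
    have : ((x.num.toNat : ℤ) : ℝ) = (x.num : ℝ) := by rw [Int.toNat_of_nonneg hnum.le]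
    rw [← Int.cast_natCast (R := ℝ) x.num.toNat, this]
    exact_mod_cast (Rat.num_div_den x).symm
  obtain ⟨P, Q, hP, hQ, hPQ⟩ := conv r (by linarith)
  obtain ⟨p, q, hp, hq, hpq⟩ := conv ρ (by linarith)
  have hr0 : (0 : ℝ) < r := by linarith
  set τ := Real.logb 2 r with hτ
  have h2τ : (2 : ℝ) ^ τ = r := Real.rpow_logb (by norm_num) (by norm_num) hr0
  have hτt : τ ≤ t := by
    have : (2 : ℝ) ^ τ < 2 ^ t := by rw [h2τ]; exact hr2
    exact ((Real.rpow_lt_rpow_left_iff one_lt_two).1 this).le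
  have hτ0 : 0 ≤ τ := Real.logb_nonneg one_lt_two (by linarith)
  refine le_trans (csInf_le (galeSet_bdd A) (a := τ) ?_) hτt
  have h1 : 1 ≤ (p : ℝ) / q := by rw [← hpq]; linarith
  have h2 : (p : ℝ) / q < r := by rw [← hpq]; exact hρ2
  have hM := summable_massBound hq h1 h2
  refine ⟨hτ0, bigGale (stageU p q) r, ?_, ?_, ?_⟩
  · rw [hPQ] at hM ⊢
    exact bigGale_lsc (stageU_mono p q) (primrec_stageU p q)
      (fun k m v h => (stageU_spec p q h).2) hP hQ hM
  · exact bigGale_isSGale (stageU_mono p q) (fun k m v h => (stageU_spec p q h).1)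
      (fun k m v h => (stageU_spec p q h).2) hr0 h2τ hM
  · intro X hX
    have hX1 : sInf (galeSet {X}) < Real.logb 2 ρ := by
      refine lt_of_le_of_lt (h X hX) ?_
      rw [Real.lt_logb_iff_rpow_lt one_lt_two (by linarith)]
      exact hρ1
    obtain ⟨s, ⟨_, d, hd1, hd2, hd3⟩, hs⟩ := exists_lt_of_csInf_lt ⟨2, two_mem_galeSet {X}⟩ hX1
    rw [Real.lt_logb_iff_rpow_lt one_lt_two (by linarith), hpq] at hs
    exact universal_succeeds hq h1 h2 hs hd2 hd1 (hd3 X rfl)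

end Main

/-- Pointwise stability of constructive dimension: for every class `A`, the
constructive dimension of `A` is the supremum of the constructive dimensions of
the singletons of its members. -/
theorem cdim_eq_iSup (A : Set Cantor) :
    cdim A = ⨆ X ∈ A, cdim {X} := by
  have hbd : BddAbove (Set.range fun X : Cantor => ⨆ _ : X ∈ A, cdim {X}) := by
    refine ⟨2, ?_⟩
    rintro _ ⟨X, rfl⟩
    exact Real.iSup_le (fun _ => cdim_le_two _) (by norm_num)
  apply le_antisymm
  · refine cdim_le_of_forall ?_ ?_
    · exact Real.iSup_nonneg fun X => Real.iSup_nonneg fun _ => cdim_nonneg _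
    · intro X hX
      refine le_trans ?_ (le_ciSup hbd X)
      simp [hX]
  · refine Real.iSup_le (fun X => Real.iSup_le (fun hX => ?_) (cdim_nonneg A)) (cdim_nonneg A)
    exact cdim_mono (by simpa using hX)
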